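/- Let G be a finite simple undirected graph on vertex set {1, …, m} with m ≥ 2, and let I''(G) be the task-token Crew instance obtained from the reduction instance I(G) as follows: add a new player m+1 holding the card (m+1, suit m+1) together with m junk cards (pairwise distinct cards whose suits are pairwise distinct and different from all other suits in the instance); deal to each of the original players i ∈ {1,…,m} one card (f_i, suit m+1) where f_1,…,f_m are pairwise distinct values in {1,…,m}; assign to player m+1 the objective whose card is (m+1, suit m+1), carrying the task token requiring that every other objective be completed before it. Then G contains a Hamiltonian path if and only if I''(G) admits a successful play sequence respecting the task token. -/

import Mathlib

/-- A card is a pair (value, suit). -/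
abbrev Card : Type := ℕ × ℕ

/-- A trick from state `st` led by `lead` with plays `play` is legal:
every hand is nonempty, each player plays a card from their own hand,
and every player follows the led suit if able. -/
def TrickOk {p : ℕ} (st : Fin p → Finset Card) (lead : Fin p) (play : Fin p → Card) : Prop :=
  (∀ i, (st i).Nonempty) ∧ (∀ i, play i ∈ st i) ∧
  (∀ i, (play i).2 = (play lead).2 ∨ ∀ c ∈ st i, c.2 ≠ (play lead).2)

/-- Player `w` wins the trick: `w`'s card is of the led suit and strictly
beats every other card of the led suit. -/
def Wins {p : ℕ} (lead : Fin p) (play : Fin p → Card) (w : Fin p) : Prop :=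
  (play w).2 = (play lead).2 ∧
  ∀ j, j ≠ w → (play j).2 = (play lead).2 → (play j).1 < (play w).1

/-- A played trick: its leader, the card played by each player, and its winner. -/
structure Trick (p : ℕ) where
  lead : Fin p
  play : Fin p → Card
  winner : Fin p

/-- After a trick, each played card is removed from its owner's hand. -/
def nextState {p : ℕ} (st : Fin p → Finset Card) (play : Fin p → Card) :
    Fin p → Finset Card :=
  fun i => (st i).erase (play i)

/-- `PlaysFrom st lead L fin`: starting from hands `st` with `lead` to lead the
first trick, the list of tricks `L` is a legal play sequence ending in hands `fin`;
the winner of each trick leads the next. -/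
inductive PlaysFrom {p : ℕ} :
    (Fin p → Finset Card) → Fin p → List (Trick p) → (Fin p → Finset Card) → Prop
  | nil (st : Fin p → Finset Card) (lead : Fin p) : PlaysFrom st lead [] st
  | cons {st : Fin p → Finset Card} {lead : Fin p} {play : Fin p → Card} {w : Fin p}
      {rest : List (Trick p)} {fin : Fin p → Finset Card} :
      TrickOk st lead play → Wins lead play w →
      PlaysFrom (nextState st play) w rest fin →
      PlaysFrom st lead (⟨lead, play, w⟩ :: rest) fin

/-- Objective `o = (c, i)` is completed in trick `t` if card `c` is played in `t`
and player `i` wins `t`. -/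
def Completes {p : ℕ} (t : Trick p) (o : Card × Fin p) : Prop :=
  (∃ j, t.play j = o.1) ∧ t.winner = o.2

instance {p : ℕ} (t : Trick p) (o : Card × Fin p) : Decidable (Completes t o) :=
  inferInstanceAs (Decidable ((∃ j, t.play j = o.1) ∧ t.winner = o.2))

/-- A play sequence is successful if every objective is completed in some trick. -/
def Successful {p : ℕ} (O : Finset (Card × Fin p)) (L : List (Trick p)) : Prop :=
  ∀ o ∈ O, ∃ t ∈ L, Completes t o

/-- The structural conditions on a Crew instance: hands are pairwise disjoint
(cards are distinct), every objective card is in some hand, and no two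
objectives share a card. -/
def ValidInstance {p : ℕ} (hand : Fin p → Finset Card) (O : Finset (Card × Fin p)) : Prop :=
  (∀ i j : Fin p, i ≠ j → Disjoint (hand i) (hand j)) ∧
  (∀ o ∈ O, ∃ i, o.1 ∈ hand i) ∧
  (∀ o ∈ O, ∀ q ∈ O, o.1 = q.1 → o = q)

/-- The instance admits a successful play sequence (with an arbitrary first leader). -/
def HasSuccess {p : ℕ} (hand : Fin p → Finset Card) (O : Finset (Card × Fin p)) : Prop :=
  ∃ lead L fin, PlaysFrom hand lead L fin ∧ Successful O L

/-- The hand dealt to player `j` by the reduction from a graph `G`: for each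
neighbor `i` of `j`, the card `(f i j, suit i)`; the card
`(deg j + 1, suit j)`; and the junk cards of `j`. -/
def reductionHand {m : ℕ} (G : SimpleGraph (Fin m)) [DecidableRel G.Adj]
    (f : Fin m → Fin m → ℕ) (junk : Fin m → Finset Card) : Fin m → Finset Card :=
  fun j =>
    (G.neighborFinset j).image (fun i => (f i j, (i : ℕ))) ∪
      {((G.degree j + 1 : ℕ), (j : ℕ))} ∪ junk j

/-- The hands of the task-token instance I''(G): the original players (indices
below `m`) keep their reduction hand and additionally receive one card
`(g j, suit m)` of the fresh suit `m`; the new player (the last index) holds the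
card `(m+1, suit m)` together with the `m` new junk cards. -/
def taskHand {m : ℕ} (G : SimpleGraph (Fin m)) [DecidableRel G.Adj]
    (f : Fin m → Fin m → ℕ) (junk : Fin m → Finset Card)
    (g : Fin m → ℕ) (junkNew : Finset Card) : Fin (m + 1) → Finset Card :=
  fun j =>
    if h : (j : ℕ) < m then
      reductionHand G f junk ⟨j, h⟩ ∪ {(g ⟨j, h⟩, (m : ℕ))}
    else
      {((m + 1 : ℕ), (m : ℕ))} ∪ junkNew

/-- The objective of the new player: to win the card `(m+1, suit m)`. -/
def newObj (m : ℕ) : Card × Fin (m + 1) :=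
  (((m + 1 : ℕ), (m : ℕ)), Fin.last m)

/-- The objectives of the task-token instance I''(G): the original reduction
objectives together with the new player's objective. -/
def taskObjs {m : ℕ} (G : SimpleGraph (Fin m)) [DecidableRel G.Adj] :
    Finset (Card × Fin (m + 1)) :=
  Finset.univ.image
      (fun j : Fin m => ((((G.degree j + 1 : ℕ), (j : ℕ)) : Card), (j.castSucc : Fin (m + 1))))
    ∪ {newObj m}

/-- A play sequence respects the task token on the new objective if every other
objective is completed in a strictly earlier trick than the new objective. -/
def RespectsToken {m : ℕ} (G : SimpleGraph (Fin m)) [DecidableRel G.Adj]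
    (L : List (Trick (m + 1))) : Prop :=
  ∀ o ∈ taskObjs G, o ≠ newObj m →
    ∀ (a b : ℕ) (ha : a < L.length) (hb : b < L.length),
      Completes (L.get ⟨a, ha⟩) o → Completes (L.get ⟨b, hb⟩) (newObj m) → a < b

namespace PlaysFrom

variable {p : ℕ} {st fin : Fin p → Finset Card} {lead : Fin p} {L : List (Trick p)}

lemma length_le_card (h : PlaysFrom st lead L fin) (i : Fin p) : L.length ≤ (st i).card := by
  induction h with
  | nil => simp
  | @cons st lead play w rest fin hok _ _ ih =>
    have hmem := hok.2.1 i
    have hcard : (nextState st play i).card = (st i).card - 1 := Finset.card_erase_of_mem hmem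
    have hpos := Finset.card_pos.mpr ⟨_, hmem⟩
    simp only [List.length_cons]
    omega

lemma play_mem_and_wins (h : PlaysFrom st lead L fin) :
    ∀ t ∈ L, (∀ i, t.play i ∈ st i) ∧ Wins t.lead t.play t.winner := by
  induction h with
  | nil => simp
  | cons hok hwins _ ih =>
    intro t ht
    rcases List.mem_cons.mp ht with rfl | ht
    · exact ⟨hok.2.1, hwins⟩
    · exact ⟨fun i => Finset.mem_of_mem_erase ((ih t ht).1 i), (ih t ht).2⟩

lemma isChain_lead_eq_winner (h : PlaysFrom st lead L fin) :
    L.IsChain (fun t t' => t'.lead = t.winner) := by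
  induction h with
  | nil => simp
  | cons _ _ hrest ih =>
    cases hrest with
    | nil => simp
    | cons => exact List.isChain_cons_cons.mpr ⟨rfl, ih⟩

end PlaysFrom

/-- If `c k j` is the card of player `j` scheduled for the trick named `k`, in which suit `k` is
led and player `k` wins, then the tricks can be played in any order along which every winner
is able to lead the suit of the next trick. -/
lemma exists_playsFrom_of_schedule {p : ℕ} (c : Fin p → Fin p → Card)
    (hinj : ∀ j, Function.Injective (c · j))
    (hfollow : ∀ k j, (c k j).2 = k ∨ ∀ k', (c k' j).2 ≠ k)
    (hsuit : ∀ k, (c k k).2 = k)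
    (hwin : ∀ k j, j ≠ k → (c k j).2 = k → (c k j).1 < (c k k).1)
    (l : List (Fin p)) (hl : l.Nodup) (lead : Fin p)
    (hchain : (lead :: l).IsChain (fun a b => (c b a).2 = b)) :
    ∃ L fin, PlaysFrom (fun j => l.toFinset.image (c · j)) lead L fin ∧
      L.map Trick.winner = l ∧ ∀ t ∈ L, t.play = c t.winner := by
  induction l generalizing lead with
  | nil => exact ⟨[], _, .nil _ _, rfl, by simp⟩
  | cons k l ih =>
    obtain ⟨hk, hl'⟩ := List.nodup_cons.mp hl
    obtain ⟨hlead, hchain'⟩ := List.isChain_cons_cons.mp hchain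
    obtain ⟨L, fin, hL, hmap, hplay⟩ := ih hl' k hchain'
    have hmem : ∀ i, c k i ∈ (k :: l).toFinset.image (c · i) := fun i =>
      Finset.mem_image.mpr ⟨k, by simp, rfl⟩
    have hnext : nextState (fun j => (k :: l).toFinset.image (c · j)) (c k) =
        fun j => l.toFinset.image (c · j) := by
      funext j
      simp only [nextState, List.toFinset_cons, Finset.image_insert]
      refine Finset.erase_insert ?_
      simp only [Finset.mem_image, List.mem_toFinset, not_exists, not_and]
      intro k' hk' he
      exact hk (hinj j he ▸ hk')
    refine ⟨⟨lead, c k, k⟩ :: L, fin, .cons ⟨fun i => ⟨_, hmem i⟩, hmem, fun i => ?_⟩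
      ⟨(hsuit k).trans hlead.symm, fun j hj hjs => hwin k j hj (hjs.trans hlead)⟩
      (hnext ▸ hL), by simp [hmap], ?_⟩
    · rw [hlead]
      refine (hfollow k i).imp_right fun h d hd => ?_
      obtain ⟨k', -, rfl⟩ := Finset.mem_image.mp hd
      exact h k'
    · intro t ht
      rcases List.mem_cons.mp ht with rfl | ht
      · rfl
      · exact hplay t ht

/-- The trick led in suit `k` of the play along a Hamiltonian path: `σ j i` is the junk card
discarded by player `j` on suit `i`, and `τ i` the one discarded by the new player. -/
def taskSchedule {m : ℕ} (G : SimpleGraph (Fin m)) [DecidableRel G.Adj]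
    (f : Fin m → Fin m → ℕ) (g : Fin m → ℕ) (σ : Fin m → Fin m → Card) (τ : Fin m → Card)
    (k j : Fin (m + 1)) : Card :=
  Fin.lastCases (motive := fun _ => Card)
    (Fin.lastCases (motive := fun _ => Card) (m + 1, m) (fun j => (g j, m)) j)
    (fun i => Fin.lastCases (motive := fun _ => Card) (τ i)
      (fun j => if i = j then (G.degree j + 1, (j : ℕ))
        else if G.Adj j i then (f i j, (i : ℕ)) else σ j i) j) k

section taskSchedule

variable {m : ℕ} (G : SimpleGraph (Fin m)) [DecidableRel G.Adj]
  (f : Fin m → Fin m → ℕ) (g : Fin m → ℕ) (σ : Fin m → Fin m → Card) (τ : Fin m → Card)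

@[simp] lemma taskSchedule_last_last :
    taskSchedule G f g σ τ (Fin.last m) (Fin.last m) = (m + 1, m) := by
  simp [taskSchedule]

@[simp] lemma taskSchedule_last_castSucc (j : Fin m) :
    taskSchedule G f g σ τ (Fin.last m) j.castSucc = (g j, m) := by
  simp [taskSchedule]

@[simp] lemma taskSchedule_castSucc_last (i : Fin m) :
    taskSchedule G f g σ τ i.castSucc (Fin.last m) = τ i := by
  simp [taskSchedule]

@[simp] lemma taskSchedule_castSucc_castSucc (i j : Fin m) :
    taskSchedule G f g σ τ i.castSucc j.castSucc =
      if i = j then (G.degree j + 1, (j : ℕ))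
        else if G.Adj j i then (f i j, (i : ℕ)) else σ j i := by
  simp [taskSchedule]

end taskSchedule

lemma Finset.exists_injOn_image_eq_of_card_eq {α β : Type*} [DecidableEq β] [Inhabited β]
    {s : Finset α} {t : Finset β} (h : s.card = t.card) :
    ∃ φ : α → β, Set.InjOn φ s ∧ s.image φ = t := by
  classical
  let e := Finset.equivOfCardEq h
  refine ⟨fun a => if ha : a ∈ s then e ⟨a, ha⟩ else default, fun a ha b hb hab => ?_, ?_⟩
  · have ha' : a ∈ s := ha
    have hb' : b ∈ s := hb
    simpa [ha', hb', Subtype.ext_iff] using hab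
  · ext b
    simp only [Finset.mem_image]
    constructor
    · rintro ⟨a, ha, rfl⟩
      simp [ha]
    · intro hb
      exact ⟨e.symm ⟨b, hb⟩, (e.symm ⟨b, hb⟩).2, by simp⟩

section taskHand

variable {m : ℕ} (G : SimpleGraph (Fin m)) [DecidableRel G.Adj]
  (f : Fin m → Fin m → ℕ) (junk : Fin m → Finset Card) (g : Fin m → ℕ) (junkNew : Finset Card)

lemma mem_taskHand_castSucc {j : Fin m} {c : Card} :
    c ∈ taskHand G f junk g junkNew j.castSucc ↔
      (∃ i, G.Adj j i ∧ (f i j, (i : ℕ)) = c) ∨ c = (G.degree j + 1, (j : ℕ)) ∨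
        c ∈ junk j ∨ c = (g j, m) := by
  simp [taskHand, reductionHand]
  grind

lemma mem_taskHand_last {c : Card} :
    c ∈ taskHand G f junk g junkNew (Fin.last m) ↔ c = (m + 1, m) ∨ c ∈ junkNew := by
  simp [taskHand]

variable {junk junkNew}

lemma eq_or_adj_of_mem_taskHand (hjsuit : ∀ i : Fin m, ∀ c ∈ junk i, m + 1 ≤ c.2)
    {i j : Fin m} {c : Card} (hc : c ∈ taskHand G f junk g junkNew j.castSucc)
    (hs : c.2 = i) : (G.Adj j i ∧ c = (f i j, (i : ℕ))) ∨ j = i := by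
  have hi := i.isLt
  rcases (mem_taskHand_castSucc G f junk g junkNew).mp hc with ⟨i', hadj, rfl⟩ | rfl | h | rfl
  · obtain rfl : i' = i := Fin.ext hs
    exact .inl ⟨hadj, rfl⟩
  · exact .inr (Fin.ext hs)
  · have := hjsuit j c h
    omega
  · simp at hs
    omega

lemma le_suit_of_mem_taskHand_last (hjn_suit : ∀ c ∈ junkNew, m + 1 ≤ c.2)
    {c : Card} (hc : c ∈ taskHand G f junk g junkNew (Fin.last m)) : m ≤ c.2 := by
  rcases (mem_taskHand_last G f junk g junkNew).mp hc with rfl | h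
  · simp
  · have := hjn_suit c h
    omega

lemma hamiltonianPath_of_playsFrom
    (hf_lt : ∀ i j : Fin m, G.Adj j i → f i j < G.degree i + 1)
    (hjsuit : ∀ i : Fin m, ∀ c ∈ junk i, m + 1 ≤ c.2)
    (hjn_card : junkNew.card = m) (hjn_suit : ∀ c ∈ junkNew, m + 1 ≤ c.2) (hm : 0 < m)
    {lead : Fin (m + 1)} {L : List (Trick (m + 1))} {fin : Fin (m + 1) → Finset Card}
    (hplays : PlaysFrom (taskHand G f junk g junkNew) lead L fin)
    (hsucc : Successful (taskObjs G) L) (hresp : RespectsToken G L) :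
    ∃ (a b : Fin m) (w : G.Walk a b), w.IsHamiltonian := by
  have hobj : ∀ i : Fin m, (((G.degree i + 1, (i : ℕ)) : Card), i.castSucc) ∈ taskObjs G := by
    simp [taskObjs]
  have hnew : newObj m ∈ taskObjs G := by simp [taskObjs]
  have hlen : L.length ≤ m + 1 := by
    refine (hplays.length_le_card (Fin.last m)).trans ?_
    have : taskHand G f junk g junkNew (Fin.last m) = insert (m + 1, m) junkNew := by
      ext; simp [mem_taskHand_last]
    rw [this]
    exact (Finset.card_insert_le _ _).trans (by omega)
  have hsurj : Function.Surjective (fun n : Fin L.length => (L.get n).winner) := by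
    intro k
    induction k using Fin.lastCases with
    | last =>
      obtain ⟨t, ht, hc⟩ := hsucc _ hnew
      obtain ⟨n, rfl⟩ := List.mem_iff_get.mp ht
      exact ⟨n, hc.2⟩
    | cast i =>
      obtain ⟨t, ht, hc⟩ := hsucc _ (hobj i)
      obtain ⟨n, rfl⟩ := List.mem_iff_get.mp ht
      exact ⟨n, hc.2⟩
  have hlen' : L.length = m + 1 := by
    have := Fintype.card_le_of_surjective _ hsurj
    simp at this
    omega
  have hinj : Function.Injective (fun n : Fin L.length => (L.get n).winner) :=
    ((Fintype.bijective_iff_surjective_and_card _).mpr ⟨hsurj, by simp [hlen']⟩).1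
  have hcompl : ∀ (n : Fin L.length) (o : Card × Fin (m + 1)), o ∈ taskObjs G →
      (L.get n).winner = o.2 → Completes (L.get n) o := by
    intro n o ho hw
    obtain ⟨t, ht, hc⟩ := hsucc o ho
    obtain ⟨n', rfl⟩ := List.mem_iff_get.mp ht
    rwa [hinj (hw.trans hc.2.symm)]
  have hwin_suit : ∀ (n : Fin L.length) (i : Fin m), (L.get n).winner = i.castSucc →
      ((L.get n).play (L.get n).lead).2 = i := by
    intro n i hw
    obtain ⟨⟨j, hj⟩, -⟩ := hcompl n _ (hobj i) hw
    obtain ⟨hmem, hwins⟩ := hplays.play_mem_and_wins _ (L.get_mem n)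
    have hmj := hmem j
    simp only at hj
    rw [← hwins.1]
    suffices j = i.castSucc by rw [hw, ← this, hj]
    rw [hj] at hmj
    induction j using Fin.lastCases with
    | last =>
      have := le_suit_of_mem_taskHand_last G f g hjn_suit hmj
      have := i.isLt
      simp at *
      omega
    | cast j =>
      rcases eq_or_adj_of_mem_taskHand G f g hjsuit hmj rfl with ⟨hadj, he⟩ | rfl
      · have := hf_lt i j hadj
        simp at he
        omega
      · rfl
  have hlast : ∀ n : Fin L.length, (L.get n).winner = Fin.last m → (n : ℕ) = m := by
    intro n hn
    by_contra hne
    have hml : m < L.length := by omega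
    have hw : (L.get ⟨m, hml⟩).winner ≠ Fin.last m := fun h =>
      hne (congrArg Fin.val (hinj (hn.trans h.symm)))
    obtain ⟨i, hi⟩ := Fin.exists_castSucc_eq.mpr hw
    have := hresp _ (hobj i) (by simp [newObj, (Fin.castSucc_lt_last i).ne]) m n hml n.isLt
      (hcompl _ _ (hobj i) hi.symm) (hcompl n _ hnew hn)
    omega
  have hex : ∀ n : Fin m, ∃ i : Fin m,
      i.castSucc = (L.get ⟨n, by omega⟩).winner := fun n =>
    Fin.exists_castSucc_eq.mpr fun h => n.isLt.ne (hlast _ h)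
  choose u hu using hex
  have hu_inj : Function.Injective u := by
    intro a b hab
    have := hinj ((hu a).symm.trans ((congrArg Fin.castSucc hab).trans (hu b)))
    exact Fin.ext (by simpa using this)
  have hne : List.ofFn u ≠ [] := by simpa using hm.ne'
  have hchain : (List.ofFn u).IsChain G.Adj := by
    rw [List.isChain_iff_getElem]
    intro n hn
    simp only [List.length_ofFn] at hn
    simp only [List.getElem_ofFn]
    have hlead := List.isChain_iff_getElem.mp hplays.isChain_lead_eq_winner n (by omega)
    have hs := hwin_suit ⟨n + 1, by omega⟩ _ (hu ⟨n + 1, hn⟩).symm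
    have hmem := (hplays.play_mem_and_wins _ (L.get_mem ⟨n + 1, by omega⟩)).1
      (L.get ⟨n + 1, by omega⟩).lead
    have hlead' : (L.get ⟨n + 1, by omega⟩).lead = (u ⟨n, by omega⟩).castSucc := by
      rw [hu]; exact hlead
    rw [hlead'] at hmem hs
    rcases eq_or_adj_of_mem_taskHand G f g hjsuit hmem hs with h | h
    · exact h.1
    · simpa using hu_inj h
  refine ⟨_, _, .ofSupport _ hne hchain, SimpleGraph.Walk.IsPath.isHamiltonian_of_mem ?_ ?_⟩
  · rw [SimpleGraph.Walk.isPath_def, SimpleGraph.Walk.support_ofSupport]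
    exact List.nodup_ofFn.mpr hu_inj
  · intro v
    rw [SimpleGraph.Walk.support_ofSupport, List.mem_ofFn]
    exact Finite.injective_iff_surjective.mp hu_inj v

lemma exists_playsFrom_of_isHamiltonian
    (hf_lt : ∀ i j : Fin m, G.Adj j i → f i j < G.degree i + 1)
    (hg_le : ∀ i, g i ≤ m)
    (hjcard : ∀ i, (junk i).card = m - G.degree i - 1)
    (hjsuit : ∀ i : Fin m, ∀ c ∈ junk i, m + 1 ≤ c.2)
    (hjn_card : junkNew.card = m) (hjn_suit : ∀ c ∈ junkNew, m + 1 ≤ c.2)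
    {a b : Fin m} {w : G.Walk a b} (hw : w.IsHamiltonian) :
    ∃ lead L fin, PlaysFrom (taskHand G f junk g junkNew) lead L fin ∧
      Successful (taskObjs G) L ∧ RespectsToken G L := by
  have hσ : ∀ j : Fin m, ∃ φ : Fin m → Card,
      Set.InjOn φ ((insert j (G.neighborFinset j))ᶜ : Finset (Fin m)) ∧
        Finset.image φ (insert j (G.neighborFinset j))ᶜ = junk j := by
    refine fun j => Finset.exists_injOn_image_eq_of_card_eq ?_
    rw [Finset.card_compl, Finset.card_insert_of_notMem (by simp), hjcard]
    simp
    omega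
  choose σ hσ_inj hσ_img using hσ
  obtain ⟨τ, hτ_inj, hτ_img⟩ := Finset.exists_injOn_image_eq_of_card_eq
    (s := (Finset.univ : Finset (Fin m))) (t := junkNew) (by simp [hjn_card])
  have hσ_mem : ∀ j i, ¬ i = j → ¬ G.Adj j i → σ j i ∈ junk j := fun j i h h' => by
    rw [← hσ_img]
    exact Finset.mem_image_of_mem _ (by simp [h, h'])
  have hτ_mem : ∀ i, τ i ∈ junkNew := fun i => by
    rw [← hτ_img]
    exact Finset.mem_image_of_mem _ (by simp)
  have hσ_suit : ∀ j i, ¬ i = j → ¬ G.Adj j i → m + 1 ≤ (σ j i).2 := fun j i h h' =>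
    hjsuit j _ (hσ_mem j i h h')
  have hτ_suit : ∀ i, m + 1 ≤ (τ i).2 := fun i => hjn_suit _ (hτ_mem i)
  set c := taskSchedule G f g σ τ with hc
  have hhand : taskHand G f junk g junkNew = fun j => Finset.univ.image (c · j) := by
    funext j
    ext d
    simp only [Finset.mem_image, Finset.mem_univ, true_and, Fin.exists_fin_succ']
    induction j using Fin.lastCases with
    | last =>
      simp only [hc, mem_taskHand_last, taskSchedule_castSucc_last, taskSchedule_last_last,
        ← hτ_img, Finset.mem_image, Finset.mem_univ, true_and]
      grind
    | cast j =>
      simp only [hc, mem_taskHand_castSucc, taskSchedule_castSucc_castSucc,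
        taskSchedule_last_castSucc, ← hσ_img, Finset.mem_image, Finset.mem_compl,
        Finset.mem_insert, SimpleGraph.mem_neighborFinset, not_or]
      constructor
      · rintro (⟨i, hadj, rfl⟩ | rfl | ⟨i, ⟨hij, hadj⟩, rfl⟩ | rfl)
        · exact .inl ⟨i, by simp [hadj, hadj.ne']⟩
        · exact .inl ⟨j, by simp⟩
        · exact .inl ⟨i, by simp [hij, hadj]⟩
        · exact .inr rfl
      · rintro (⟨i, rfl⟩ | rfl)
        · split_ifs with h₁ h₂
          · exact .inr (.inl rfl)
          · exact .inl ⟨i, h₂, rfl⟩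
          · exact .inr (.inr (.inl ⟨i, ⟨h₁, h₂⟩, rfl⟩))
        · exact .inr (.inr (.inr rfl))
  have hcases : ∀ k j, (c k j).2 = k ∨ m + 1 ≤ (c k j).2 := by
    intro k j
    induction k using Fin.lastCases with
    | last => induction j using Fin.lastCases <;> simp [hc]
    | cast i =>
      induction j using Fin.lastCases with
      | last => simpa [hc] using .inr (hτ_suit i)
      | cast j =>
        simp only [hc, taskSchedule_castSucc_castSucc]
        split_ifs with h₁ h₂
        · simp [h₁]
        · simp
        · exact .inr (hσ_suit j i h₁ h₂)
  have hcinj : ∀ j, Function.Injective (c · j) := by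
    intro j k k' he
    have he : c k j = c k' j := he
    have hk := k.isLt
    have hk' := k'.isLt
    have h₁ := hcases k j
    have h₂ := hcases k' j
    rw [← he] at h₂
    by_cases hs : (c k j).2 = k
    · exact Fin.ext (by omega)
    have hs' : (c k' j).2 ≠ k' := by rw [← he]; omega
    induction j using Fin.lastCases with
    | last =>
      induction k using Fin.lastCases with
      | last => simp [hc] at hs
      | cast i =>
        induction k' using Fin.lastCases with
        | last => simp [hc] at hs'
        | cast i' =>
          simp only [hc, taskSchedule_castSucc_last] at he
          rw [hτ_inj (by simp) (by simp) he]
    | cast j =>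
      induction k using Fin.lastCases with
      | last => simp [hc] at hs
      | cast i =>
        induction k' using Fin.lastCases with
        | last => simp [hc] at hs'
        | cast i' =>
          simp only [hc, taskSchedule_castSucc_castSucc] at he hs hs'
          split_ifs at he hs hs' <;> try simp_all
          rw [hσ_inj j (by simp [*]) (by simp [*]) he]
  have hfollow : ∀ k j, (c k j).2 = k ∨ ∀ k', (c k' j).2 ≠ k := by
    intro k j
    refine or_iff_not_imp_left.mpr fun hs k' hs' => ?_
    have := k.isLt
    have := hcases k' j
    obtain rfl : k' = k := Fin.ext (by omega)
    exact hs hs'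
  have hsuit : ∀ k, (c k k).2 = k := by
    intro k
    induction k using Fin.lastCases <;> simp [hc]
  have hwins : ∀ k j, j ≠ k → (c k j).2 = k → (c k j).1 < (c k k).1 := by
    intro k j hjk hs
    induction k using Fin.lastCases with
    | last =>
      induction j using Fin.lastCases with
      | last => exact absurd rfl hjk
      | cast j => simpa [hc] using Nat.lt_succ_of_le (hg_le j)
    | cast i =>
      have hi := i.isLt
      induction j using Fin.lastCases with
      | last =>
        have := hτ_suit i
        simp [hc] at hs
        omega
      | cast j =>
        have hij : ¬ i = j := fun h => hjk (h ▸ rfl)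
        simp only [hc, taskSchedule_castSucc_castSucc, if_neg hij, if_true] at hs ⊢
        split_ifs at hs ⊢ with hadj
        · exact hf_lt i j hadj
        · have := hσ_suit j i hij hadj
          simp at hs
          omega
  have hnodup : (w.support.map Fin.castSucc ++ [Fin.last m]).Nodup := by
    refine List.nodup_append.mpr
      ⟨hw.isPath.support_nodup.map (Fin.castSucc_injective m), by simp, ?_⟩
    simp [Fin.castSucc_ne_last]
  have huniv : (w.support.map Fin.castSucc ++ [Fin.last m]).toFinset = Finset.univ := by
    ext k
    induction k using Fin.lastCases <;> simp [hw.mem_support]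
  have hchain : (a.castSucc :: (w.support.map Fin.castSucc ++ [Fin.last m])).IsChain
      (fun x y => (c y x).2 = y) := by
    have hsupp : (w.support.map Fin.castSucc).IsChain (fun x y => (c y x).2 = y) := by
      rw [List.isChain_map]
      refine w.isChain_adj_support.imp fun x y hadj => ?_
      simp [hc, hadj, hadj.ne']
    have hall : (w.support.map Fin.castSucc ++ [Fin.last m]).IsChain
        (fun x y => (c y x).2 = y) := by
      refine hsupp.append (.singleton _) ?_
      intro x hx y hy
      obtain rfl : Fin.last m = y := by simpa using hy
      obtain ⟨i, -, rfl⟩ := List.mem_map.mp (List.mem_of_mem_getLast? hx)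
      simp [hc]
    rw [← w.cons_tail_support] at hall ⊢
    exact List.isChain_cons_cons.mpr ⟨hsuit _, hall⟩
  obtain ⟨L, fin, hL, hmap, hplay⟩ := exists_playsFrom_of_schedule c hcinj hfollow hsuit hwins
    _ hnodup _ hchain
  rw [huniv, ← hhand] at hL
  refine ⟨_, L, fin, hL, fun o ho => ?_, fun o ho hne n n' hn hn' hcn hcn' => ?_⟩
  · have hco : c o.2 o.2 = o.1 := by
      simp only [taskObjs, Finset.mem_union, Finset.mem_image, Finset.mem_univ, true_and,
        Finset.mem_singleton] at ho
      rcases ho with ⟨i, rfl⟩ | rfl <;> simp [hc, newObj]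
    have hmem : o.2 ∈ L.map Trick.winner := by
      rw [hmap, ← List.mem_toFinset, huniv]
      exact Finset.mem_univ _
    obtain ⟨t, ht, hto⟩ := List.mem_map.mp hmem
    exact ⟨t, ht, ⟨o.2, by rw [hplay t ht, hto, hco]⟩, hto⟩
  · obtain ⟨i, rfl⟩ : ∃ i : Fin m, ((G.degree i + 1, (i : ℕ)), i.castSucc) = o := by
      simp only [taskObjs, Finset.mem_union, Finset.mem_image, Finset.mem_univ, true_and,
        Finset.mem_singleton] at ho
      exact ho.resolve_right hne
    have hlen : L.length = w.support.length + 1 := by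
      simpa using congrArg List.length hmap
    have hwinner : ∀ n (hn : n < L.length), L[n].winner =
        (w.support.map Fin.castSucc ++ [Fin.last m])[n]'(by
          simp only [List.length_append, List.length_map, List.length_singleton]; omega) := by
      intro n hn
      simp [← hmap]
    have h₁ : L[n].winner = i.castSucc := hcn.2
    have h₂ : L[n'].winner = Fin.last m := hcn'.2
    rw [hwinner, List.getElem_append] at h₁ h₂
    simp only [List.length_map, List.getElem_map, List.getElem_singleton] at h₁ h₂
    split_ifs at h₁ h₂ with h₃ h₄
    · exact absurd h₂ (Fin.castSucc_ne_last _)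
    · omega
    all_goals exact absurd h₁.symm (Fin.castSucc_ne_last _)

end taskHand

/-- G has a Hamiltonian path iff the task-token instance I''(G)
admits a successful play sequence that respects the task token requiring the new
player's objective to be completed after all other objectives. -/
theorem hamiltonianPath_iff_crew_taskToken_success {m : ℕ} (hm : 2 ≤ m)
    (G : SimpleGraph (Fin m)) [DecidableRel G.Adj]
    (f : Fin m → Fin m → ℕ)
    (hf_inj : ∀ i : Fin m, Set.InjOn (f i) (G.neighborFinset i))
    (hf_img : ∀ i : Fin m, (G.neighborFinset i).image (f i) = Finset.Icc 1 (G.degree i))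
    (junk : Fin m → Finset Card)
    (hjcard : ∀ i, (junk i).card = m - G.degree i - 1)
    (hjsuit : ∀ i : Fin m, ∀ c ∈ junk i, m + 1 ≤ c.2)
    (hjdist : ∀ (i i' : Fin m) (c c' : Card), c ∈ junk i → c' ∈ junk i' →
      c.2 = c'.2 → i = i' ∧ c = c')
    (g : Fin m → ℕ) (hg_inj : Function.Injective g)
    (hg_mem : ∀ i, g i ∈ Finset.Icc 1 m)
    (junkNew : Finset Card)
    (hjn_card : junkNew.card = m)
    (hjn_suit : ∀ c ∈ junkNew, m + 1 ≤ c.2)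
    (hjn_dist : ∀ c ∈ junkNew, ∀ c' ∈ junkNew, c.2 = c'.2 → c = c')
    (hjn_cross : ∀ (i : Fin m) (c c' : Card), c ∈ junk i → c' ∈ junkNew → c.2 ≠ c'.2) :
    (∃ (a b : Fin m) (w : G.Walk a b), w.IsHamiltonian) ↔
      ∃ lead L fin,
        PlaysFrom (taskHand G f junk g junkNew) lead L fin ∧
        Successful (taskObjs G) L ∧
        RespectsToken G L := by
  have hf_lt : ∀ i j : Fin m, G.Adj j i → f i j < G.degree i + 1 := by
    intro i j hadj
    have : f i j ∈ (G.neighborFinset i).image (f i) :=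
      Finset.mem_image_of_mem _ (by simpa using hadj.symm)
    rw [hf_img] at this
    exact Nat.lt_succ_of_le (Finset.mem_Icc.mp this).2
  constructor
  · rintro ⟨a, b, w, hw⟩
    exact exists_playsFrom_of_isHamiltonian G f g hf_lt (fun i => (Finset.mem_Icc.mp (hg_mem i)).2)
      hjcard hjsuit hjn_card hjn_suit hw
  · rintro ⟨lead, L, fin, hplays, hsucc, hresp⟩
    exact hamiltonianPath_of_playsFrom G f g hf_lt hjsuit hjn_card hjn_suit (by omega)
      hplays hsucc hresp
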